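/- For all i, j ∈ ℕ the following identity holds in K[x]: B_q(i)·B_q(j) = Σ_{k=max(i,j)}^{i+j} (q^{(k−i)(k−j)}·[k]_q! / ([k−i]_q!·[k−j]_q!·[i+j−k]_q!)) · B_q(k). Moreover each coefficient q^{(k−i)(k−j)}·[k]_q!/([k−i]_q![k−j]_q![i+j−k]_q!) equals q^{(k−i)(k−j)}·qbinom(k, i+j−k)·qbinom(2k−i−j, k−i), a polynomial in q with natural number coefficients. -/

import Mathlib

open Polynomial

noncomputable section

/-- `K = ℚ(q)`, the field of rational functions in `q` over `ℚ`. -/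
abbrev K : Type := RatFunc ℚ

/-- The variable `q ∈ K`. -/
def qq : K := RatFunc.X

/-- The quantum integer `[n]_q = (q^n - 1)/(q - 1) ∈ K`. -/
def qInt (n : ℤ) : K := (qq ^ n - 1) / (qq - 1)

/-- The quantum factorial `[n]_q! = ∏_{i=1}^n [i]_q`. -/
def qFact (n : ℕ) : K := ∏ i ∈ Finset.range n, qInt ((i : ℤ) + 1)

/-- The Gaussian binomial coefficient `qbinom(n,k) ∈ K`. -/
def qBinom (n k : ℕ) : K := if k ≤ n then qFact n / (qFact k * qFact (n - k)) else 0

/-- The `q`-binomial coefficient polynomial `B_q(k) ∈ K[x]`, with `B_q(0) = 1`. -/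
def Bq (k : ℕ) : K[X] :=
  C ((qq ^ (k.choose 2) * qFact k)⁻¹) * ∏ i ∈ Finset.range k, (X - C (qInt i))

lemma qq_ne : qq ≠ 0 := RatFunc.X_ne_zero

lemma qq_pow_ne_one (n : ℕ) : qq ^ (n + 1) ≠ 1 := by
  intro h
  have h1 : algebraMap ℚ[X] (RatFunc ℚ) (X ^ (n + 1)) = algebraMap ℚ[X] (RatFunc ℚ) 1 := by
    simpa [qq, RatFunc.algebraMap_X] using h
  have h2 := RatFunc.algebraMap_injective ℚ h1
  have h3 := congrArg Polynomial.natDegree h2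
  simp at h3

lemma qq_sub_ne : qq - 1 ≠ 0 := by
  have := qq_pow_ne_one 0
  simpa [sub_eq_zero] using this

lemma qInt_zero : qInt 0 = 0 := by simp [qInt]

lemma qInt_succ_ne (n : ℕ) : qInt ((n : ℤ) + 1) ≠ 0 := by
  unfold qInt
  refine div_ne_zero ?_ qq_sub_ne
  rw [sub_ne_zero]
  exact_mod_cast qq_pow_ne_one n

lemma qInt_add (a b : ℤ) : qInt (a + b) = qInt a + qq ^ a * qInt b := by
  have := qq_sub_ne
  unfold qInt
  rw [zpow_add₀ qq_ne]
  field_simp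
  ring

lemma qFact_succ (n : ℕ) : qFact (n + 1) = qFact n * qInt ((n : ℤ) + 1) := by
  simp [qFact, Finset.prod_range_succ]

lemma qFact_ne (n : ℕ) : qFact n ≠ 0 :=
  Finset.prod_ne_zero_iff.2 fun i _ => qInt_succ_ne i

/-- Inverse quantum factorial, extended by zero to negative integers. -/
def invF (n : ℤ) : K := if 0 ≤ n then (qFact n.toNat)⁻¹ else 0

lemma invF_nat (n : ℕ) : invF n = (qFact n)⁻¹ := by simp [invF]

lemma invF_neg {n : ℤ} (h : n < 0) : invF n = 0 := by simp [invF, h]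

lemma invF_zero : invF 0 = 1 := by simp [invF, qFact]

lemma invF_step (n : ℤ) : invF (n - 1) = qInt n * invF n := by
  rcases lt_trichotomy n 0 with h | h | h
  · rw [invF_neg h, invF_neg (by omega)]; simp
  · subst h; rw [invF_neg (by omega), qInt_zero]; simp
  · obtain ⟨m, rfl⟩ : ∃ m : ℕ, n = m + 1 := ⟨(n - 1).toNat, by omega⟩
    have e : ((m : ℤ) + 1) = ((m + 1 : ℕ) : ℤ) := by push_cast; rfl
    rw [add_sub_cancel_right, invF_nat]
    conv_rhs => rw [e, invF_nat, qFact_succ]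
    have := qInt_succ_ne m
    have := qFact_ne m
    push_cast
    field_simp

/-- Structure constants, with integer-extended factorials. -/
def cc (i j k : ℕ) : K :=
  qq ^ (((k : ℤ) - i) * ((k : ℤ) - j)) * qFact k * invF ((k : ℤ) - i) * invF ((k : ℤ) - j)
    * invF ((i : ℤ) + j - k)

lemma cc_eq (i j k : ℕ) (hi : i ≤ k) (hj : j ≤ k) (hk : k ≤ i + j) :
    cc i j k = qq ^ ((k - i) * (k - j)) * qFact k /
          (qFact (k - i) * qFact (k - j) * qFact (i + j - k)) := by
  unfold cc
  have e1 : (k : ℤ) - i = ((k - i : ℕ) : ℤ) := by omega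
  have e2 : (k : ℤ) - j = ((k - j : ℕ) : ℤ) := by omega
  have e3 : (i : ℤ) + j - k = ((i + j - k : ℕ) : ℤ) := by omega
  rw [e1, e2, e3, invF_nat, invF_nat, invF_nat, ← Nat.cast_mul, zpow_natCast]
  have := qFact_ne (k - i)
  have := qFact_ne (k - j)
  have := qFact_ne (i + j - k)
  field_simp

lemma cc_out (i j k : ℕ) (h : ¬ (i ≤ k ∧ j ≤ k ∧ k ≤ i + j)) : cc i j k = 0 := by
  unfold cc
  by_cases h1 : i ≤ k
  · by_cases h2 : j ≤ k
    · rw [invF_neg (n := (i : ℤ) + j - k) (by omega)]; simp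
    · rw [invF_neg (n := (k : ℤ) - j) (by omega)]; simp
  · rw [invF_neg (n := (k : ℤ) - i) (by omega)]; simp

lemma cc_rec (i j k : ℕ) :
    qq ^ j * qInt ((j : ℤ) + 1) * cc i (j + 1) (k + 1) =
      qq ^ k * qInt ((k : ℤ) + 1) * cc i j k
        + qq ^ j * qInt (((k + 1 : ℕ) : ℤ) - j) * cc i j (k + 1) := by
  unfold cc
  push_cast
  have f1 : invF ((k : ℤ) - i) = qInt ((k : ℤ) + 1 - i) * invF ((k : ℤ) + 1 - i) := by
    rw [← invF_step]; congr 1; ring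
  have f2 : invF ((k : ℤ) - j) = qInt ((k : ℤ) + 1 - j) * invF ((k : ℤ) + 1 - j) := by
    rw [← invF_step]; congr 1; ring
  have f3 : invF ((i : ℤ) + j - (k + 1)) = qInt ((i : ℤ) + j - k) * invF ((i : ℤ) + j - k) := by
    rw [← invF_step]; congr 1; ring
  have g1 : (k : ℤ) + 1 - (j + 1) = k - j := by ring
  have g2 : (i : ℤ) + (j + 1) - (k + 1) = i + j - k := by ring
  have a : qInt ((j : ℤ) + 1) = qInt ((k : ℤ) + 1 - i)
      + qq ^ ((k : ℤ) + 1 - i) * qInt ((i : ℤ) + j - k) := by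
    rw [← qInt_add]; congr 1; ring
  have p1 : qq ^ k * qq ^ (((k : ℤ) - i) * ((k : ℤ) - j)) =
      qq ^ j * qq ^ (((k : ℤ) + 1 - i) * ((k : ℤ) - j)) := by
    rw [← zpow_natCast, ← zpow_natCast, ← zpow_add₀ qq_ne, ← zpow_add₀ qq_ne]
    congr 1; ring
  have p2 : qq ^ (((k : ℤ) + 1 - i) * ((k : ℤ) + 1 - j)) =
      qq ^ ((k : ℤ) + 1 - i) * qq ^ (((k : ℤ) + 1 - i) * ((k : ℤ) - j)) := by
    rw [← zpow_add₀ qq_ne]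
    congr 1; ring
  rw [g1, g2, f3, p2, f1, a, qFact_succ, f2]
  linear_combination (-(qInt ((k : ℤ) + 1) * qFact k * qInt ((k : ℤ) + 1 - i) *
    invF ((k : ℤ) + 1 - i) * qInt ((k : ℤ) + 1 - j) * invF ((k : ℤ) + 1 - j)
    * invF ((i : ℤ) + j - k))) * p1

lemma cc_rec0 (i j : ℕ) :
    qq ^ j * qInt ((j : ℤ) + 1) * cc i (j + 1) 0 =
      qq ^ j * qInt (((0 : ℕ) : ℤ) - j) * cc i j 0 := by
  rw [cc_out i (j + 1) 0 (by omega)]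
  rcases Nat.eq_zero_or_pos j with h | h
  · subst h; simp [qInt_zero]
  · rw [cc_out i j 0 (by omega)]; simp

lemma Bq_step (k : ℕ) :
    (X - C (qInt k)) * Bq k = C (qq ^ k * qInt ((k : ℤ) + 1)) * Bq (k + 1) := by
  unfold Bq
  rw [Finset.prod_range_succ, qFact_succ]
  have h : (qq ^ (k.choose 2) * qFact k)⁻¹ = (qq ^ k * qInt ((k : ℤ) + 1)) *
      (qq ^ ((k + 1).choose 2) * (qFact k * qInt ((k : ℤ) + 1)))⁻¹ := by
    have := qq_ne
    have := qFact_ne k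
    have := qInt_succ_ne k
    rw [Nat.choose_succ_succ' k 1, Nat.choose_one_right, pow_add]
    field_simp
  rw [h, C_mul]
  ring

lemma Bq_shift (j k : ℕ) :
    (X - C (qInt j)) * Bq k = C (qq ^ k * qInt ((k : ℤ) + 1)) * Bq (k + 1)
      + C (qq ^ j * qInt ((k : ℤ) - j)) * Bq k := by
  rw [← Bq_step]
  have h : qInt (k : ℤ) = qInt j + qq ^ j * qInt ((k : ℤ) - j) := by
    rw [← zpow_natCast, ← qInt_add]; congr 1; ring
  rw [h, C_add]
  ring

lemma main_sum (i j : ℕ) :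
    Bq i * Bq j = ∑ k ∈ Finset.range (i + j + 1), C (cc i j k) * Bq k := by
  induction j with
  | zero =>
    rw [Finset.sum_eq_single i]
    · have h0 : Bq 0 = 1 := by simp [Bq, qFact]
      have h1 : cc i 0 i = 1 := by
        rw [cc_eq i 0 i le_rfl (by omega) (by omega)]
        have := qFact_ne i
        have h : qFact 0 = 1 := by simp [qFact]
        simp [h, this]
      rw [h0, h1]; simp
    · intro k _ hk
      rw [cc_out i 0 k (by omega)]; simp
    · intro h; simp at h
  | succ j ih =>
    have hne : C (qq ^ j * qInt ((j : ℤ) + 1)) ≠ (0 : K[X]) := by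
      rw [Ne, C_eq_zero]
      exact mul_ne_zero (pow_ne_zero _ qq_ne) (qInt_succ_ne j)
    apply mul_left_cancel₀ hne
    have h1 : C (qq ^ j * qInt ((j : ℤ) + 1)) * (Bq i * Bq (j + 1)) =
        (X - C (qInt j)) * (Bq i * Bq j) := by
      linear_combination (-Bq i) * Bq_step j
    rw [h1, ih, Finset.mul_sum, Finset.mul_sum, ← add_assoc i j 1,
      Finset.sum_range_succ' _ (i + j + 1)]
    have h2 : ∀ k, (X - C (qInt j)) * (C (cc i j k) * Bq k) =
        C (qq ^ k * qInt ((k : ℤ) + 1) * cc i j k) * Bq (k + 1)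
        + C (qq ^ j * qInt ((k : ℤ) - j) * cc i j k) * Bq k := by
      intro k
      rw [C_mul (b := cc i j k), C_mul (b := cc i j k)]
      linear_combination C (cc i j k) * Bq_shift j k
    have h3 : ∀ k, C (qq ^ j * qInt ((j : ℤ) + 1)) * (C (cc i (j + 1) (k + 1)) * Bq (k + 1)) =
        C (qq ^ k * qInt ((k : ℤ) + 1) * cc i j k) * Bq (k + 1)
        + C (qq ^ j * qInt (((k + 1 : ℕ) : ℤ) - j) * cc i j (k + 1)) * Bq (k + 1) := by
      intro k
      rw [← mul_assoc, ← C_mul, cc_rec, C_add, add_mul]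
    have h4 : C (qq ^ j * qInt ((j : ℤ) + 1)) * (C (cc i (j + 1) 0) * Bq 0) =
        C (qq ^ j * qInt (((0 : ℕ) : ℤ) - j) * cc i j 0) * Bq 0 := by
      rw [← mul_assoc, ← C_mul, cc_rec0]
    rw [h4, Finset.sum_congr rfl (fun k _ => h2 k), Finset.sum_congr rfl (fun k _ => h3 k),
      Finset.sum_add_distrib, Finset.sum_add_distrib, add_assoc (G := K[X]),
      ← Finset.sum_range_succ'
        (fun k => C (qq ^ j * qInt ((k : ℤ) - j) * cc i j k) * Bq k) (i + j + 1),
      Finset.sum_range_succ _ (i + j + 1), cc_out i j (i + j + 1) (by omega)]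
    simp

/-- Values of polynomials with natural coefficients at `q`. -/
def natPolys : Subsemiring K := (Polynomial.eval₂RingHom (Nat.castRingHom K) qq).rangeS

lemma qq_mem : qq ∈ natPolys := ⟨X, by simp⟩

lemma gauss_mem (n k : ℕ) : qFact n * invF k * invF ((n : ℤ) - k) ∈ natPolys := by
  induction n generalizing k with
  | zero =>
    rcases Nat.eq_zero_or_pos k with h | h
    · subst h
      have : qFact 0 = 1 := by simp [qFact]
      simp [this, invF_zero, one_mem]
    · rw [invF_neg (n := ((0 : ℕ) : ℤ) - k) (by omega), mul_zero]
      exact zero_mem _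
  | succ n ih =>
    have key : qFact (n + 1) * invF k * invF (((n + 1 : ℕ) : ℤ) - k) =
        qFact n * invF ((k : ℤ) - 1) * invF ((n : ℤ) - ((k : ℤ) - 1))
        + qq ^ k * (qFact n * invF k * invF ((n : ℤ) - k)) := by
      have e1 : (n : ℤ) - ((k : ℤ) - 1) = n + 1 - k := by ring
      have e2 : invF ((n : ℤ) - k) = qInt ((n : ℤ) + 1 - k) * invF ((n : ℤ) + 1 - k) := by
        rw [← invF_step]; congr 1; ring
      have e3 : qInt ((n : ℤ) + 1) = qInt k + qq ^ k * qInt ((n : ℤ) + 1 - k) := by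
        rw [← zpow_natCast, ← qInt_add]; congr 1; ring
      push_cast
      rw [e1, e2, qFact_succ, e3, invF_step]
      ring
    rw [key]
    refine add_mem ?_ (mul_mem (pow_mem qq_mem _) (ih k))
    cases k with
    | zero =>
      rw [invF_neg (n := ((0 : ℕ) : ℤ) - 1) (by simp)]
      simp [zero_mem]
    | succ k =>
      have := ih k
      push_cast
      rwa [add_sub_cancel_right]

lemma qBinom_mem (n k : ℕ) : qBinom n k ∈ natPolys := by
  unfold qBinom
  split_ifs with h
  · have := gauss_mem n k
    rw [← Nat.cast_sub h, invF_nat, invF_nat] at this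
    rwa [div_eq_mul_inv, mul_inv, ← mul_assoc]
  · exact zero_mem _

lemma coeff_eq (i j k : ℕ) (hi : i ≤ k) (hj : j ≤ k) (hk : k ≤ i + j) :
    qq ^ ((k - i) * (k - j)) * qFact k /
          (qFact (k - i) * qFact (k - j) * qFact (i + j - k)) =
        qq ^ ((k - i) * (k - j)) * qBinom k (i + j - k) * qBinom (2 * k - i - j) (k - i) := by
  unfold qBinom
  rw [if_pos (by omega), if_pos (by omega)]
  have e1 : k - (i + j - k) = 2 * k - i - j := by omega
  have e2 : 2 * k - i - j - (k - i) = k - j := by omega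
  rw [e1, e2]
  have := qFact_ne (k - i)
  have := qFact_ne (k - j)
  have := qFact_ne (i + j - k)
  have := qFact_ne (2 * k - i - j)
  field_simp

/-- Structure constants for quantum integer-valued polynomials:
`B_q(i)·B_q(j) = Σ_{k=max(i,j)}^{i+j} q^{(k−i)(k−j)}·[k]_q!/([k−i]_q![k−j]_q![i+j−k]_q!)·B_q(k)`,
and each coefficient equals `q^{(k−i)(k−j)}·qbinom(k,i+j−k)·qbinom(2k−i−j,k−i)`, a polynomial
in `q` with natural number coefficients. -/
theorem qbinomial_mul (i j : ℕ) :
    (Bq i * Bq j = ∑ k ∈ Finset.Icc (max i j) (i + j),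
      C (qq ^ ((k - i) * (k - j)) * qFact k /
          (qFact (k - i) * qFact (k - j) * qFact (i + j - k))) * Bq k) ∧
    (∀ k ∈ Finset.Icc (max i j) (i + j),
      qq ^ ((k - i) * (k - j)) * qFact k /
          (qFact (k - i) * qFact (k - j) * qFact (i + j - k)) =
        qq ^ ((k - i) * (k - j)) * qBinom k (i + j - k) * qBinom (2 * k - i - j) (k - i)) ∧
    (∀ k ∈ Finset.Icc (max i j) (i + j),
      ∃ g : Polynomial ℕ,
        qq ^ ((k - i) * (k - j)) * qFact k /
            (qFact (k - i) * qFact (k - j) * qFact (i + j - k)) =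
          g.eval₂ (Nat.castRingHom K) qq) := by
  refine ⟨?_, ?_, ?_⟩
  · rw [main_sum]
    symm
    have hs : Finset.Icc (max i j) (i + j) ⊆ Finset.range (i + j + 1) := by
      intro k hk
      simp only [Finset.mem_Icc, Finset.mem_range] at *
      omega
    rw [← Finset.sum_subset hs]
    · refine Finset.sum_congr rfl fun k hk => ?_
      simp only [Finset.mem_Icc] at hk
      rw [cc_eq i j k (by omega) (by omega) (by omega)]
    · intro k _ hk
      simp only [Finset.mem_Icc] at hk
      rw [cc_out i j k (by omega)]
      simp
  · intro k hk
    simp only [Finset.mem_Icc] at hk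
    exact coeff_eq i j k (by omega) (by omega) (by omega)
  · intro k hk
    simp only [Finset.mem_Icc] at hk
    rw [coeff_eq i j k (by omega) (by omega) (by omega)]
    obtain ⟨g, hg⟩ := mul_mem (mul_mem (pow_mem qq_mem ((k - i) * (k - j)))
      (qBinom_mem k (i + j - k))) (qBinom_mem (2 * k - i - j) (k - i))
    exact ⟨g, hg.symm⟩
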